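/- Let (x*, x) be a primitive pair of points of Z^3, let C₁ > 1, let α ∈ (0,1/2) be badly approximable with constant C₁ with convergents (p_n, q_n), and let Y, X' ∈ R and n ≥ 2 satisfy 2(||x*|| + ||x||) ≤ Y ≤ X' and q_{n-1} ≤ 2X'/Y < q_n. Then there exist y, x' ∈ Z^3 such that: det(x*, x, y) = 1, det(x*, x, x') = q_n, det(y, x, x') = -p_n (so (x,x') is a primitive pair); Y ≤ ||y|| ≤ 2Y and X' ≤ ||x'|| ≤ 5C₁X'; dist(x*, x') ≤ ||x||/(2X') + 2C₁/(Y ||x*|| ||x|| dist(x*,x)); and the unit vectors u ⊥ span(x*,x) and u' ⊥ span(x,x') satisfy dist(u,u') ≤ 2C₁/(Y ||x*|| ||x|| dist(x*,x) dist(x,x')). -/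

import Mathlib

noncomputable section

/-- Cross product in ℝ³. -/
def cross3 (x y : Fin 3 → ℝ) : Fin 3 → ℝ :=
  ![x 1 * y 2 - x 2 * y 1, x 2 * y 0 - x 0 * y 2, x 0 * y 1 - x 1 * y 0]

/-- Scalar product in ℝ³. -/
def dot3 (x y : Fin 3 → ℝ) : ℝ := x 0 * y 0 + x 1 * y 1 + x 2 * y 2

/-- Euclidean norm in ℝ³. -/
def nrm (x : Fin 3 → ℝ) : ℝ := Real.sqrt (dot3 x x)

/-- Projective distance between nonzero vectors of ℝ³. -/
def pdist (x y : Fin 3 → ℝ) : ℝ := nrm (cross3 x y) / (nrm x * nrm y)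

/-- The canonical map ℤ³ → ℝ³. -/
def toR (x : Fin 3 → ℤ) : Fin 3 → ℝ := fun i => (x i : ℝ)

/-- Determinant of three vectors of ℝ³. -/
def det3 (a b c : Fin 3 → ℝ) : ℝ :=
  a 0 * (b 1 * c 2 - b 2 * c 1) - a 1 * (b 0 * c 2 - b 2 * c 0) + a 2 * (b 0 * c 1 - b 1 * c 0)

/-- Determinant of three vectors of ℤ³. -/
def det3Z (a b c : Fin 3 → ℤ) : ℤ :=
  a 0 * (b 1 * c 2 - b 2 * c 1) - a 1 * (b 0 * c 2 - b 2 * c 0) + a 2 * (b 0 * c 1 - b 1 * c 0)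

/-- Cross product of integer vectors. -/
def crossZ (x y : Fin 3 → ℤ) : Fin 3 → ℤ :=
  ![x 1 * y 2 - x 2 * y 1, x 2 * y 0 - x 0 * y 2, x 0 * y 1 - x 1 * y 0]

/-- A point of ℤ³ is primitive if its coordinates are coprime (in particular it is nonzero). -/
def IsPrimitive (x : Fin 3 → ℤ) : Prop := Int.gcd (Int.gcd (x 0) (x 1)) (x 2) = 1

/-- A pair of points of ℤ³ is primitive if their cross product is a primitive point. -/
def PrimPair (x y : Fin 3 → ℤ) : Prop := IsPrimitive (crossZ x y)

/-- The golden ratio. -/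
def γ : ℝ := (1 + Real.sqrt 5) / 2

lemma nrm_eq_norm (a : Fin 3 → ℝ) : nrm a = ‖(WithLp.toLp 2 a : EuclideanSpace ℝ (Fin 3))‖ := by
  rw [EuclideanSpace.norm_eq]
  simp [nrm, dot3, Fin.sum_univ_three, pow_two]

lemma nrm_nonneg (a : Fin 3 → ℝ) : 0 ≤ nrm a := Real.sqrt_nonneg _

lemma nrm_sq (a : Fin 3 → ℝ) : nrm a ^ 2 = dot3 a a := by
  unfold nrm
  rw [Real.sq_sqrt]
  unfold dot3
  linarith [mul_self_nonneg (a 0), mul_self_nonneg (a 1), mul_self_nonneg (a 2)]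

lemma nrm_add_le (a b : Fin 3 → ℝ) : nrm (a + b) ≤ nrm a + nrm b := by
  simp only [nrm_eq_norm, WithLp.toLp_add]
  exact norm_add_le _ _

lemma nrm_smul (c : ℝ) (a : Fin 3 → ℝ) : nrm (c • a) = |c| * nrm a := by
  simp only [nrm_eq_norm, WithLp.toLp_smul, norm_smul, Real.norm_eq_abs]

lemma nrm_le_add_perp (z v : Fin 3 → ℝ) (h : dot3 z v = 0) : nrm z ≤ nrm (z + v) := by
  refine (sq_le_sq₀ (nrm_nonneg _) (nrm_nonneg _)).mp ?_
  rw [nrm_sq, nrm_sq]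
  have h2 : dot3 (z + v) (z + v) = dot3 z z + 2 * dot3 z v + dot3 v v := by
    simp only [dot3, Pi.add_apply]; ring
  have h3 : 0 ≤ dot3 v v := by unfold dot3; linarith [mul_self_nonneg (v 0), mul_self_nonneg (v 1), mul_self_nonneg (v 2)]
  rw [h2, h]; linarith

lemma lagrange3 (a b : Fin 3 → ℝ) :
    nrm (cross3 a b) ^ 2 + dot3 a b ^ 2 = nrm a ^ 2 * nrm b ^ 2 := by
  simp only [nrm_sq, dot3, cross3, Matrix.cons_val]
  ring

lemma nrm_cross_le (a b : Fin 3 → ℝ) : nrm (cross3 a b) ≤ nrm a * nrm b := by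
  refine (sq_le_sq₀ (nrm_nonneg _) (mul_nonneg (nrm_nonneg _) (nrm_nonneg _))).mp ?_
  have := lagrange3 a b
  nlinarith [sq_nonneg (dot3 a b)]

lemma nrm_ge_one (x : Fin 3 → ℤ) (h : x ≠ 0) : 1 ≤ nrm (toR x) := by
  have h1 : (1 : ℤ) ≤ x 0 * x 0 + x 1 * x 1 + x 2 * x 2 := by
    by_contra hc
    have h0 := mul_self_nonneg (x 0)
    have h1 := mul_self_nonneg (x 1)
    have h2 := mul_self_nonneg (x 2)
    apply h
    funext i
    fin_cases i
    · exact mul_self_eq_zero.mp (by linarith : x 0 * x 0 = 0)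
    · exact mul_self_eq_zero.mp (by linarith : x 1 * x 1 = 0)
    · exact mul_self_eq_zero.mp (by linarith : x 2 * x 2 = 0)
  unfold nrm
  rw [Real.one_le_sqrt]
  simp only [dot3, toR]
  exact_mod_cast h1

lemma prim_ne_zero (x : Fin 3 → ℤ) (h : IsPrimitive x) : x ≠ 0 := by
  rintro rfl
  simp [IsPrimitive] at h

lemma prim_bezout (x : Fin 3 → ℤ) (h : IsPrimitive x) :
    ∃ y : Fin 3 → ℤ, x 0 * y 0 + x 1 * y 1 + x 2 * y 2 = 1 := by
  unfold IsPrimitive at h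
  have h1 := Int.gcd_eq_gcd_ab (x 0) (x 1)
  have h2 := Int.gcd_eq_gcd_ab (Int.gcd (x 0) (x 1)) (x 2)
  rw [h] at h2
  set g := Int.gcdA (Int.gcd (x 0) (x 1)) (x 2)
  set g' := Int.gcdB (Int.gcd (x 0) (x 1)) (x 2)
  refine ⟨![Int.gcdA (x 0) (x 1) * g, Int.gcdB (x 0) (x 1) * g, g'], ?_⟩
  simp only [Matrix.cons_val]
  rw [h1] at h2
  push_cast at h2
  linarith

lemma prim_of_comb (x a b : Fin 3 → ℤ) (c d : ℤ)
    (h : c * (x 0 * a 0 + x 1 * a 1 + x 2 * a 2) + d * (x 0 * b 0 + x 1 * b 1 + x 2 * b 2) = 1) :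
    IsPrimitive x := by
  unfold IsPrimitive
  set g := Int.gcd (Int.gcd (x 0) (x 1)) (x 2) with hg
  have h01 : (g : ℤ) ∣ Int.gcd (x 0) (x 1) := Int.gcd_dvd_left _ _
  have h2 : (g : ℤ) ∣ x 2 := Int.gcd_dvd_right _ _
  have h0 : (g : ℤ) ∣ x 0 := h01.trans (Int.gcd_dvd_left _ _)
  have h1 : (g : ℤ) ∣ x 1 := h01.trans (Int.gcd_dvd_right _ _)
  have : (g : ℤ) ∣ 1 := by
    rw [← h]
    have hh : ∀ y : Fin 3 → ℤ, (g : ℤ) ∣ x 0 * y 0 + x 1 * y 1 + x 2 * y 2 := fun y =>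
      dvd_add (dvd_add (h0.mul_right _) (h1.mul_right _)) (h2.mul_right _)
    exact dvd_add ((hh a).mul_left _) ((hh b).mul_left _)
  exact_mod_cast Int.eq_one_of_dvd_one (by positivity) this

lemma toR_cross (a b : Fin 3 → ℤ) : toR (crossZ a b) = cross3 (toR a) (toR b) := by
  funext i
  fin_cases i <;> simp [toR, crossZ, cross3]

/-- A unit vector orthogonal to `a` and `b` is a multiple of the cross product. -/
lemma unit_perp (a b u : Fin 3 → ℝ) (hw : 0 < nrm (cross3 a b)) (hu : nrm u = 1)
    (ha : dot3 u a = 0) (hb : dot3 u b = 0) :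
    ∃ c : ℝ, |c| = 1 / nrm (cross3 a b) ∧ u = c • cross3 a b := by
  set w := cross3 a b with hwd
  have hx : cross3 w u = 0 := by
    funext i
    simp only [dot3] at ha hb
    fin_cases i <;> simp only [hwd, cross3, Matrix.cons_val, Fin.zero_eta, Fin.mk_one,
      Fin.reduceFinMk, Pi.zero_apply]
    · linear_combination (b 0) * ha - (a 0) * hb
    · linear_combination (b 1) * ha - (a 1) * hb
    · linear_combination (b 2) * ha - (a 2) * hb
  have hl := lagrange3 w u
  have h0 : nrm (0 : Fin 3 → ℝ) = 0 := by simp [nrm, dot3]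
  rw [hx, hu, h0] at hl
  have habs : |dot3 w u| = nrm w := by
    rw [← abs_of_pos hw]
    apply (sq_eq_sq_iff_abs_eq_abs _ _).mp
    linarith
  have hn := nrm_sq w
  refine ⟨dot3 w u / nrm w ^ 2, ?_, ?_⟩
  · rw [abs_div, habs, abs_of_pos (by positivity)]
    field_simp
  · have key : ∀ i, nrm w ^ 2 * u i = dot3 w u * w i := by
      have e0 := congrFun hx 0
      have e1 := congrFun hx 1
      have e2 := congrFun hx 2
      simp only [cross3, Matrix.cons_val, Pi.zero_apply] at e0 e1 e2
      intro i
      rw [hn]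
      fin_cases i <;> simp only [dot3, Fin.zero_eta, Fin.mk_one, Fin.reduceFinMk]
      · linear_combination (w 2) * e1 - (w 1) * e2
      · linear_combination (w 0) * e2 - (w 2) * e0
      · linear_combination (w 1) * e0 - (w 0) * e1
    funext i
    simp only [Pi.smul_apply, smul_eq_mul]
    have := key i
    field_simp
    linarith

lemma nrm_cross_cross (a b c : Fin 3 → ℝ) :
    nrm (cross3 (cross3 a b) (cross3 b c)) = |det3 a b c| * nrm b := by
  rw [← nrm_smul]
  congr 1
  funext i
  fin_cases i <;> simp [cross3, det3] <;> ring

/-- The angle estimate between the two normals. -/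
lemma angle_bound (a b c u u' : Fin 3 → ℝ) (K Q : ℝ) (hb : 0 < nrm b) (ha : 0 < nrm a)
    (hc : 0 < nrm c)
    (hw : 0 < nrm (cross3 a b)) (hw' : 0 < nrm (cross3 b c)) (hQ : |det3 a b c| = Q)
    (hK : Q ≤ K * nrm c)
    (hu : nrm u = 1) (hua : dot3 u a = 0) (hub : dot3 u b = 0)
    (hu' : nrm u' = 1) (hub' : dot3 u' b = 0) (huc : dot3 u' c = 0) :
    pdist u u' ≤ K / (nrm a * nrm b * pdist a b * pdist b c) := by
  obtain ⟨d, hd, rfl⟩ := unit_perp a b u hw hu hua hub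
  obtain ⟨d', hd', rfl⟩ := unit_perp b c u' hw' hu' hub' huc
  have hcr : nrm (cross3 (d • cross3 a b) (d' • cross3 b c)) = |d| * |d'| * (Q * nrm b) := by
    rw [← hQ, ← nrm_cross_cross, ← abs_mul, ← nrm_smul]
    congr 1
    funext i
    fin_cases i <;> simp [cross3] <;> ring
  unfold pdist
  rw [hcr, hu, hu', hd, hd']
  set W := nrm (cross3 a b)
  set W' := nrm (cross3 b c)
  have e1 : 1 / W * (1 / W') * (Q * nrm b) / (1 * 1) = Q * nrm b / (W * W') := by field_simp
  have e2 : K / (nrm a * nrm b * (W / (nrm a * nrm b)) * (W' / (nrm b * nrm c)))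
      = (K * nrm c) * nrm b / (W * W') := by field_simp
  rw [e1, e2]
  gcongr

lemma perp_decomp (a b y : Fin 3 → ℝ) (hw : 0 < nrm (cross3 a b)) (hd : det3 a b y = 1) :
    ∃ (s t : ℝ) (v : Fin 3 → ℝ), y = v + s • a + t • b ∧ dot3 a v = 0 ∧ dot3 b v = 0 ∧
      nrm v = 1 / nrm (cross3 a b) := by
  set w := cross3 a b with hwd
  have hn : nrm w ^ 2 = det3 a b w := by
    rw [nrm_sq, hwd]; simp only [dot3, det3, cross3, Matrix.cons_val]; ring
  have hne : det3 a b w ≠ 0 := by rw [← hn]; positivity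
  refine ⟨det3 y b w / nrm w ^ 2, det3 a y w / nrm w ^ 2, (1 / nrm w ^ 2) • w, ?_, ?_, ?_, ?_⟩
  · funext i
    have key : det3 a b w * y i = det3 a b y * w i + det3 y b w * a i + det3 a y w * b i := by
      fin_cases i <;> simp only [det3, Fin.zero_eta, Fin.mk_one, Fin.reduceFinMk] <;> ring
    rw [hd] at key
    simp only [Pi.add_apply, Pi.smul_apply, smul_eq_mul]
    rw [hn]
    field_simp
    linarith
  · simp only [dot3, hwd, cross3, Matrix.cons_val, Pi.smul_apply, smul_eq_mul]; ring
  · simp only [dot3, hwd, cross3, Matrix.cons_val, Pi.smul_apply, smul_eq_mul]; ring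
  · rw [nrm_smul, abs_of_pos (by positivity)]
    field_simp

/-- Size of `z = v + σ a + r b`. -/
lemma size_bounds (a b v : Fin 3 → ℝ) (σ r k L : ℝ) (hσ : 0 ≤ σ) (hk : 0 ≤ k) (hr : |r| ≤ 1 / 2)
    (hav : dot3 a v = 0) (hbv : dot3 b v = 0) (hv : nrm v ≤ L) :
    σ * nrm a - nrm b / 2 ≤ nrm (k • v + σ • a + r • b) ∧
      nrm (k • v + σ • a + r • b) ≤ k * L + σ * nrm a + nrm b / 2 := by
  have hb := nrm_nonneg b
  have hrb : nrm (r • b) ≤ nrm b / 2 := by rw [nrm_smul]; nlinarith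
  have hsa : nrm (σ • a) = σ * nrm a := by rw [nrm_smul, abs_of_nonneg hσ]
  constructor
  · have h1 : nrm (σ • a + r • b) ≤ nrm (k • v + σ • a + r • b) := by
      have : k • v + σ • a + r • b = (σ • a + r • b) + k • v := by abel
      rw [this]
      apply nrm_le_add_perp
      simp only [dot3, Pi.add_apply, Pi.smul_apply, smul_eq_mul] at *
      linear_combination (σ * k) * hav + (r * k) * hbv
    have h2 := nrm_add_le (σ • a + r • b) (-r • b)
    have h3 : (σ • a + r • b) + -r • b = σ • a := by module
    have h4 : nrm (-r • b) ≤ nrm b / 2 := by rw [nrm_smul, abs_neg]; nlinarith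
    rw [h3] at h2
    linarith
  · have h1 := nrm_add_le (k • v + σ • a) (r • b)
    have h2 := nrm_add_le (k • v) (σ • a)
    have h3 : nrm (k • v) ≤ k * L := by
      rw [nrm_smul, abs_of_nonneg hk]; gcongr
    linarith

set_option maxHeartbeats 2000000 in
/-- The recursive step (Lemma 3 of the paper). -/
theorem stmt14 (C₁ α : ℝ) (hC : 1 < C₁) (hα : α ∈ Set.Ioo (0 : ℝ) (1/2))
    (hbad : ∀ p q : ℤ, q ≠ 0 → 1 / (C₁ * |(q : ℝ)|) ≤ |(q : ℝ) * α - (p : ℝ)|)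
    (p q : ℕ → ℤ)
    (hpq : ∀ n : ℕ, 1 ≤ n → 0 ≤ p n ∧ p n ≤ q n) (hp1 : p 1 = 0) (hq1 : q 1 = 1)
    (hdet : ∀ n : ℕ, 1 ≤ n → q n * p (n + 1) - p n * q (n + 1) = (-1 : ℤ) ^ (n + 1))
    (happ : ∀ n : ℕ, 1 ≤ n → |(q n : ℝ) * α - (p n : ℝ)| < 1 / (q (n + 1) : ℝ))
    (hgrow : ∀ n : ℕ, 1 ≤ n → q n < q (n + 1) ∧ (q (n + 1) : ℝ) ≤ C₁ * (q n : ℝ))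
    (xs x : Fin 3 → ℤ) (hprim : PrimPair xs x)
    (Y X' : ℝ) (n : ℕ) (hn : 2 ≤ n)
    (hY : 2 * (nrm (toR xs) + nrm (toR x)) ≤ Y) (hYX : Y ≤ X')
    (hql : (q (n - 1) : ℝ) ≤ 2 * X' / Y) (hqr : 2 * X' / Y < (q n : ℝ)) :
    ∃ y x' : Fin 3 → ℤ,
      det3Z xs x y = 1 ∧ det3Z xs x x' = q n ∧ det3Z y x x' = -(p n) ∧
      PrimPair x x' ∧
      Y ≤ nrm (toR y) ∧ nrm (toR y) ≤ 2 * Y ∧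
      X' ≤ nrm (toR x') ∧ nrm (toR x') ≤ 5 * C₁ * X' ∧
      pdist (toR xs) (toR x') ≤ nrm (toR x) / (2 * X') +
        2 * C₁ / (Y * nrm (toR xs) * nrm (toR x) * pdist (toR xs) (toR x)) ∧
      ∀ u u' : Fin 3 → ℝ,
        nrm u = 1 → dot3 u (toR xs) = 0 → dot3 u (toR x) = 0 →
        nrm u' = 1 → dot3 u' (toR x) = 0 → dot3 u' (toR x') = 0 →
        pdist u u' ≤ 2 * C₁ /
          (Y * nrm (toR xs) * nrm (toR x) * pdist (toR xs) (toR x) *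
            pdist (toR x) (toR x')) := by
  have hwne := prim_ne_zero _ hprim
  have hW1 : 1 ≤ nrm (cross3 (toR xs) (toR x)) := by
    rw [← toR_cross]; exact nrm_ge_one _ hwne
  have ha1 : 1 ≤ nrm (toR xs) := by
    apply nrm_ge_one
    rintro rfl
    apply hwne
    funext i
    fin_cases i <;> simp [crossZ]
  have hb1 : 1 ≤ nrm (toR x) := by
    apply nrm_ge_one
    rintro rfl
    apply hwne
    funext i
    fin_cases i <;> simp [crossZ]
  obtain ⟨y0, hy0⟩ := prim_bezout _ hprim
  have hy0' : det3Z xs x y0 = 1 := by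
    rw [← hy0]; simp only [det3Z, crossZ, Matrix.cons_val]; ring
  have hy0R : det3 (toR xs) (toR x) (toR y0) = 1 := by
    simp only [det3, toR]
    have := hy0'
    simp only [det3Z] at this
    exact_mod_cast this
  obtain ⟨s0, t0, v, hdec, hav, hbv, hv⟩ := perp_decomp _ _ _ (by linarith) hy0R
  -- facts on the denominators
  obtain ⟨m, rfl⟩ : ∃ m, n = m + 1 := ⟨n - 1, by omega⟩
  have hm : 1 ≤ m := by omega
  rw [Nat.add_sub_cancel] at hql
  have hcop := hdet m hm
  obtain ⟨hp0, hpqn⟩ := hpq (m + 1) (by omega)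
  obtain ⟨hmono, hgr⟩ := hgrow m hm
  have hqm0 : 0 ≤ q m := (hpq m hm).1.trans (hpq m hm).2
  have hQ1 : (1 : ℤ) ≤ q (m + 1) := by omega
  generalize q (m + 1) = Q at *
  generalize p (m + 1) = P at *
  have hQ1' : (1 : ℝ) ≤ Q := by exact_mod_cast hQ1
  have hP0 : (0 : ℝ) ≤ P := by exact_mod_cast hp0
  have hPQ : (P : ℝ) ≤ Q := by exact_mod_cast hpqn
  have hYpos : 0 < Y := by linarith
  have hQY : (Q : ℝ) * Y ≤ 2 * C₁ * X' := by
    rw [le_div_iff₀ hYpos] at hql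
    nlinarith
  have hQY' : 2 * X' < Q * Y := by
    rwa [div_lt_iff₀ hYpos] at hqr
  -- the choice of the integers
  set A := nrm (toR xs) with hA
  set B := nrm (toR x) with hB
  set W := nrm (cross3 (toR xs) (toR x)) with hW
  have hApos : 0 < A := by linarith
  have hBpos : 0 < B := by linarith
  have hWpos : 0 < W := by linarith
  set k : ℤ := ⌈(Y + B / 2) / A - s0⌉ with hk
  set s : ℝ := s0 + k with hs
  have hs1 : Y + B / 2 ≤ s * A := by
    have := Int.le_ceil ((Y + B / 2) / A - s0)
    rw [← hk] at this
    rw [← div_le_iff₀ hApos]; linarith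
  have hs2 : s * A ≤ Y + B / 2 + A := by
    have := Int.ceil_lt_add_one ((Y + B / 2) / A - s0)
    rw [← hk] at this
    have h2 : s ≤ (Y + B / 2) / A + 1 := by linarith
    calc s * A ≤ ((Y + B / 2) / A + 1) * A := by gcongr
      _ = _ := by field_simp
  have hspos : 0 < s := by
    by_contra hc
    push Not at hc
    nlinarith
  set t : ℝ := t0 - round t0 with ht
  have ht2 : |t| ≤ 1 / 2 := abs_sub_round t0
  set r : ℝ := Q * t - round (Q * t) with hr
  have hr2 : |r| ≤ 1 / 2 := abs_sub_round _
  set y : Fin 3 → ℤ := y0 + k • xs - round t0 • x with hyd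
  set x' : Fin 3 → ℤ := P • xs - round (Q * t) • x + Q • y with hxd
  have hyR : toR y = (1 : ℝ) • v + s • toR xs + t • toR x := by
    funext i
    have := congrFun hdec i
    simp only [toR, Pi.add_apply, Pi.smul_apply, smul_eq_mul, hyd, Pi.sub_apply] at this ⊢
    push_cast
    rw [this, hs, ht]
    ring
  have hxR : toR x' = (Q : ℝ) • v + (P + Q * s) • toR xs + r • toR x := by
    funext i
    have := congrFun hyR i
    simp only [toR, Pi.add_apply, Pi.smul_apply, smul_eq_mul, hxd, Pi.sub_apply] at this ⊢
    push_cast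
    rw [this, hr]
    ring
  have hvL : nrm v ≤ 1 := by
    rw [hv, div_le_one hWpos]; exact hW1
  obtain ⟨hy1, hy2⟩ := size_bounds (toR xs) (toR x) v s t 1 1 hspos.le zero_le_one ht2 hav hbv hvL
  obtain ⟨hx1, hx2⟩ := size_bounds (toR xs) (toR x) v (P + Q * s) r Q 1 (by positivity)
    (by positivity) hr2 hav hbv hvL
  rw [← hyR] at hy1 hy2
  rw [← hxR] at hx1 hx2
  rw [← hA, ← hB] at hy1 hy2 hx1 hx2
  have hdy : det3Z xs x y = 1 := by
    rw [← hy0']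
    simp only [det3Z, hyd, Pi.add_apply, Pi.sub_apply, Pi.smul_apply, smul_eq_mul]; ring
  have hdx : det3Z xs x x' = Q := by
    have : det3Z xs x x' = Q * det3Z xs x y := by
      simp only [det3Z, hxd, Pi.add_apply, Pi.sub_apply, Pi.smul_apply, smul_eq_mul]; ring
    rw [this, hdy, mul_one]
  have hdp : det3Z y x x' = -P := by
    have : det3Z y x x' = -P * det3Z xs x y := by
      simp only [det3Z, hxd, Pi.add_apply, Pi.sub_apply, Pi.smul_apply, smul_eq_mul]; ring
    rw [this, hdy, mul_one]
  have hprim' : PrimPair x x' := by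
    have e1 : crossZ x x' 0 * xs 0 + crossZ x x' 1 * xs 1 + crossZ x x' 2 * xs 2 = Q := by
      rw [← hdx]; simp only [det3Z, crossZ, Matrix.cons_val]; ring
    have e2 : crossZ x x' 0 * y 0 + crossZ x x' 1 * y 1 + crossZ x x' 2 * y 2 = -P := by
      rw [← hdp]; simp only [det3Z, crossZ, Matrix.cons_val]; ring
    have hsq : ((-1 : ℤ) ^ (m + 1)) * (-1) ^ (m + 1) = 1 := by
      rw [← mul_pow]; simp
    apply prim_of_comb _ xs y (-(-1) ^ (m + 1) * p m) (-(-1) ^ (m + 1) * q m)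
    rw [e1, e2]
    linear_combination (-1) ^ (m + 1) * hcop + hsq
  have hW'1 : 1 ≤ nrm (cross3 (toR x) (toR x')) := by
    rw [← toR_cross]; exact nrm_ge_one _ (prim_ne_zero _ hprim')
  have hxlow : X' ≤ nrm (toR x') := by
    have h1 : (Q : ℝ) * (Y + B / 2) ≤ Q * (s * A) := by gcongr
    nlinarith [mul_nonneg hP0 hApos.le]
  have hxpos : 0 < nrm (toR x') := by linarith
  have hX'pos : 0 < X' := by linarith
  refine ⟨y, x', hdy, hdx, hdp, hprim', by linarith, by linarith, hxlow, ?_, ?_, ?_⟩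
  · have h1 : (Q : ℝ) * (s * A) ≤ Q * (Y + B / 2 + A) := by gcongr
    have h2 : (P : ℝ) * A ≤ Q * A := by gcongr
    have h3 : (Q : ℝ) * (B + 2 * A + 1) ≤ Q * Y := by
      gcongr; linarith
    have h4 : B / 2 ≤ Q * (B / 2) := by nlinarith
    nlinarith
  · have hcr : cross3 (toR xs) (toR x') =
        r • cross3 (toR xs) (toR x) + (Q : ℝ) • cross3 (toR xs) v := by
      rw [hxR]
      funext i
      fin_cases i <;> simp [cross3] <;> ring
    have hle : nrm (cross3 (toR xs) (toR x')) ≤ 1 / 2 * (A * B) + Q * (A * (1 / W)) := by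
      rw [hcr]
      refine (nrm_add_le _ _).trans ?_
      rw [nrm_smul, nrm_smul, abs_of_nonneg (by positivity : (0 : ℝ) ≤ Q)]
      have h1 := nrm_cross_le (toR xs) v
      rw [hv] at h1
      have h2 := nrm_cross_le (toR xs) (toR x)
      gcongr
    have hpW : Y * A * B * pdist (toR xs) (toR x) = Y * W := by
      unfold pdist; rw [← hA, ← hB, ← hW]; field_simp
    rw [hpW]
    unfold pdist
    rw [← hA]
    calc nrm (cross3 (toR xs) (toR x')) / (A * nrm (toR x'))
        ≤ (1 / 2 * (A * B) + Q * (A * (1 / W))) / (A * X') := by gcongr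
      _ = B / (2 * X') + (Q * Y) / (Y * W * X') := by field_simp
      _ ≤ B / (2 * X') + (2 * C₁ * X') / (Y * W * X') := by gcongr
      _ = _ := by field_simp
  · intro u u' hu hua hub hu' hub' huc
    have hdR : |det3 (toR xs) (toR x) (toR x')| = (Q : ℝ) := by
      have : det3 (toR xs) (toR x) (toR x') = (Q : ℝ) := by
        rw [← hdx]; simp only [det3, det3Z, toR]; push_cast; ring
      rw [this, abs_of_nonneg (by positivity)]
    have hK : (Q : ℝ) ≤ 2 * C₁ / Y * nrm (toR x') := by
      have : (Q : ℝ) ≤ 2 * C₁ / Y * X' := by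
        rw [div_mul_eq_mul_div, le_div_iff₀ hYpos]; exact hQY
      exact this.trans (by gcongr)
    have := angle_bound (toR xs) (toR x) (toR x') u u' _ _ hBpos hApos hxpos hWpos
      (by linarith) hdR hK hu hua hub hu' hub' huc
    refine this.trans (le_of_eq ?_)
    rw [div_div, ← hA, ← hB]
    congr 1
    ring
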